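/- arXiv:2301.05758 — 2 statements merged into one kernel-verified Lean document; each statement's English description precedes it below -/
import Mathlib

section
/- Let P be the Pell sequence (P_0 = 0, P_1 = 1, P_n = 2P_{n-1} + P_{n-2}) and Q the associated Pell sequence (Q_0 = 1, Q_1 = 1, Q_n = 2Q_{n-1} + Q_{n-2}). Define σ_P(k,n) = Σ_{i=1}^{k} P_{n+i}. For all k ≥ 1 with k even and all n ≥ 0: σ_P(k,n) = (Q_{n+k+1} − Q_{n+1})/2; moreover if k ≡ 0 (mod 4) then σ_P(k,n) = 2·P_{k/2}·P_{k/2+n+1}, and if k ≡ 2 (mod 4) then σ_P(k,n) = Q_{k/2}·Q_{k/2+n+1}. -/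
/-- The Pell sequence: P₀ = 0, P₁ = 1, Pₙ = 2Pₙ₋₁ + Pₙ₋₂. -/
def pell : ℕ → ℤ
  | 0 => 0
  | 1 => 1
  | n + 2 => 2 * pell (n + 1) + pell n

/-- The associated Pell sequence: Q₀ = 1, Q₁ = 1, Qₙ = 2Qₙ₋₁ + Qₙ₋₂. -/
def assocPell : ℕ → ℤ
  | 0 => 1
  | 1 => 1
  | n + 2 => 2 * assocPell (n + 1) + assocPell n

theorem pell_succ_and_assocPell_succ (n : ℕ) :
    pell (n + 1) = pell n + assocPell n ∧
      assocPell (n + 1) = assocPell n + 2 * pell n := by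
  induction n with
  | zero => simp [pell, assocPell]
  | succ n ih =>
    obtain ⟨hP, hQ⟩ := ih
    rw [pell, assocPell]
    constructor <;> linarith

theorem pell_succ (n : ℕ) : pell (n + 1) = pell n + assocPell n :=
  (pell_succ_and_assocPell_succ n).1

theorem assocPell_succ (n : ℕ) : assocPell (n + 1) = assocPell n + 2 * pell n :=
  (pell_succ_and_assocPell_succ n).2

theorem pell_add_and_assocPell_add (m n : ℕ) :
    pell (m + n) = pell m * assocPell n + assocPell m * pell n ∧
      assocPell (m + n) = assocPell m * assocPell n + 2 * pell m * pell n := by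
  induction n with
  | zero => simp [pell, assocPell]
  | succ n ih =>
    obtain ⟨hP, hQ⟩ := ih
    rw [← add_assoc, pell_succ (m + n), assocPell_succ (m + n), pell_succ n, assocPell_succ n,
      hP, hQ]
    constructor <;> ring

theorem pell_add (m n : ℕ) :
    pell (m + n) = pell m * assocPell n + assocPell m * pell n :=
  (pell_add_and_assocPell_add m n).1

theorem assocPell_add (m n : ℕ) :
    assocPell (m + n) = assocPell m * assocPell n + 2 * pell m * pell n :=
  (pell_add_and_assocPell_add m n).2

theorem assocPell_sq_sub_two_mul_pell_sq (n : ℕ) :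
    assocPell n ^ 2 - 2 * pell n ^ 2 = (-1) ^ n := by
  induction n with
  | zero => simp [pell, assocPell]
  | succ n ih =>
    rw [pell_succ, assocPell_succ, pow_succ (-1 : ℤ), ← ih]
    ring

theorem neg_one_pow_mul_assocPell (m n : ℕ) :
    (-1) ^ m * assocPell n = assocPell m * assocPell (m + n) - 2 * pell m * pell (m + n) := by
  rw [pell_add, assocPell_add, ← assocPell_sq_sub_two_mul_pell_sq]
  ring

theorem two_mul_sum_pell (k n : ℕ) :
    2 * (∑ i ∈ Finset.Icc 1 k, pell (n + i)) = assocPell (n + k + 1) - assocPell (n + 1) := by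
  induction k with
  | zero => simp
  | succ k ih =>
    rw [Finset.sum_Icc_succ_top (by omega), mul_add, ih, ← add_assoc n k 1,
      assocPell_succ (n + k + 1)]
    ring

theorem sigma_pell (k n : ℕ) (hk : 1 ≤ k) (hke : k % 2 = 0) :
    2 * (∑ i ∈ Finset.Icc 1 k, pell (n + i)) = assocPell (n + k + 1) - assocPell (n + 1) ∧
    (k % 4 = 0 →
      ∑ i ∈ Finset.Icc 1 k, pell (n + i) = 2 * pell (k / 2) * pell (k / 2 + n + 1)) ∧
    (k % 4 = 2 →
      ∑ i ∈ Finset.Icc 1 k, pell (n + i) = assocPell (k / 2) * assocPell (k / 2 + n + 1)) := by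
  have hsum := two_mul_sum_pell k n
  obtain ⟨m, rfl⟩ : ∃ m, k = 2 * m := ⟨k / 2, by omega⟩
  have hhalf : 2 * m / 2 = m := by omega
  have hadd := assocPell_add m (m + (n + 1))
  have hsub := neg_one_pow_mul_assocPell m (n + 1)
  rw [show m + (m + (n + 1)) = n + 2 * m + 1 by ring, ← add_assoc m n 1] at hadd
  rw [← add_assoc m n 1] at hsub
  rw [hhalf]
  refine ⟨hsum, fun h => ?_, fun h => ?_⟩
  · rw [Even.neg_one_pow (Nat.even_iff.mpr (by omega))] at hsub
    linarith
  · rw [Odd.neg_one_pow (Nat.odd_iff.mpr (by omega))] at hsub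
    linarith
end

section
/- Let P be the Pell sequence (P_0 = 0, P_1 = 1, P_n = 2P_{n-1} + P_{n-2}), Q the associated Pell sequence (Q_0 = 1, Q_1 = 1, Q_n = 2Q_{n-1} + Q_{n-2}), and c the Lucas-cobalancing sequence (c_0 = −1, c_1 = 1, c_n = 6c_{n-1} − c_{n-2}). For every k ≥ 1, the greatest common divisor of the set { Σ_{i=1}^{k} c_{n+i} : n ≥ 0 } of all sums of k consecutive Lucas-cobalancing numbers equals 4·P_k if k is even, and equals Q_k if k is odd. -/
/-- The Lucas-cobalancing sequence: c₀ = −1, c₁ = 1, cₙ = 6cₙ₋₁ − cₙ₋₂. -/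
def lucasCobalancing : ℕ → ℤ
  | 0 => -1
  | 1 => 1
  | n + 2 => 6 * lucasCobalancing (n + 1) - lucasCobalancing n

/-- `d` is the greatest common divisor of the set `{S n : n ≥ 0}`: `d ≥ 1`, `d` divides
every element of the set, and every common divisor of the set divides `d`. -/
def IsSetGCD (S : ℕ → ℤ) (d : ℤ) : Prop :=
  1 ≤ d ∧ (∀ n : ℕ, d ∣ S n) ∧ ∀ e : ℤ, (∀ n : ℕ, e ∣ S n) → e ∣ d

/-- The balancing numbers: B₀ = 0, B₁ = 1, Bₙ = 6Bₙ₋₁ − Bₙ₋₂. -/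
def balancing : ℕ → ℤ
  | 0 => 0
  | 1 => 1
  | n + 2 => 6 * balancing (n + 1) - balancing n

theorem balancing_add_add_one (m n : ℕ) :
    balancing (m + n + 1) =
      balancing (m + 1) * balancing (n + 1) - balancing m * balancing n := by
  induction n using Nat.twoStepInduction with
  | zero => simp [balancing]
  | one => simp [balancing]; ring
  | more n ih₁ ih₂ =>
    have h : balancing (m + (n + 2) + 1) =
      6 * balancing (m + (n + 1) + 1) - balancing (m + n + 1) := rfl
    have h₁ : balancing (n + 2 + 1) = 6 * balancing (n + 2) - balancing (n + 1) := rfl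
    have h₂ : balancing (n + 2) = 6 * balancing (n + 1) - balancing n := rfl
    rw [h, ih₁, ih₂, h₁]
    linear_combination balancing m * h₂

theorem balancing_add (m n : ℕ) :
    balancing (m + n) = balancing m * balancing (n + 1) + balancing (m + 1) * balancing n
      - 6 * balancing m * balancing n := by
  cases m with
  | zero => simp [balancing]
  | succ m =>
    have h : balancing (m + 1 + 1) = 6 * balancing (m + 1) - balancing m := rfl
    rw [Nat.add_right_comm, balancing_add_add_one, h]
    ring

theorem lucasCobalancing_add_one (n : ℕ) :
    lucasCobalancing (n + 1) = balancing (n + 1) + balancing n := by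
  induction n using Nat.twoStepInduction with
  | zero => rfl
  | one => rfl
  | more n ih₁ ih₂ =>
    have h : lucasCobalancing (n + 2 + 1) =
      6 * lucasCobalancing (n + 1 + 1) - lucasCobalancing (n + 1) := rfl
    have h₁ : balancing (n + 2 + 1) = 6 * balancing (n + 2) - balancing (n + 1) := rfl
    have h₂ : balancing (n + 2) = 6 * balancing (n + 1) - balancing n := rfl
    rw [h, ih₁, ih₂, h₁]
    linear_combination -h₂

theorem pell_two_mul (n : ℕ) : pell (2 * n) = 2 * balancing n := by
  induction n using Nat.twoStepInduction with
  | zero => rfl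
  | one => rfl
  | more n ih₁ ih₂ =>
    have h₂ : pell (2 * (n + 1)) = 2 * pell (2 * n + 1) + pell (2 * n) := rfl
    have h₃ : pell (2 * n + 3) = 2 * pell (2 * (n + 1)) + pell (2 * n + 1) := rfl
    have h₄ : pell (2 * (n + 2)) = 2 * pell (2 * n + 3) + pell (2 * (n + 1)) := rfl
    have h : balancing (n + 2) = 6 * balancing (n + 1) - balancing n := rfl
    linarith

theorem assocPell_two_mul_add_one (n : ℕ) :
    assocPell (2 * n + 1) = lucasCobalancing (n + 1) := by
  induction n using Nat.twoStepInduction with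
  | zero => rfl
  | one => rfl
  | more n ih₁ ih₂ =>
    have h₃ : assocPell (2 * (n + 1) + 1) =
      2 * assocPell (2 * n + 2) + assocPell (2 * n + 1) := rfl
    have h₄ : assocPell (2 * n + 4) =
      2 * assocPell (2 * (n + 1) + 1) + assocPell (2 * n + 2) := rfl
    have h₅ : assocPell (2 * (n + 2) + 1) =
      2 * assocPell (2 * n + 4) + assocPell (2 * (n + 1) + 1) := rfl
    have h : lucasCobalancing (n + 2 + 1) =
      6 * lucasCobalancing (n + 1 + 1) - lucasCobalancing (n + 1) := rfl
    linarith

theorem pell_nonneg (n : ℕ) : 0 ≤ pell n := by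
  induction n using Nat.twoStepInduction with
  | zero => simp [pell]
  | one => simp [pell]
  | more n ih₁ ih₂ => rw [pell]; positivity

theorem pell_pos {n : ℕ} (hn : 1 ≤ n) : 0 < pell n := by
  induction n, hn using Nat.le_induction with
  | base => simp [pell]
  | succ n hn ih =>
    obtain ⟨m, rfl⟩ := Nat.exists_eq_add_of_le' hn
    rw [pell]
    linarith [pell_nonneg m]

theorem assocPell_pos (n : ℕ) : 0 < assocPell n := by
  induction n using Nat.twoStepInduction with
  | zero => simp [assocPell]
  | one => simp [assocPell]
  | more n ih₁ ih₂ => rw [assocPell]; positivity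

theorem sum_lucasCobalancing_two_mul (n j : ℕ) :
    ∑ i ∈ Finset.Icc 1 (2 * j), lucasCobalancing (n + i) =
      4 * pell (2 * j) * balancing (n + j) := by
  rw [pell_two_mul]
  induction j with
  | zero => simp [balancing]
  | succ j ih =>
    rw [Nat.mul_succ, Finset.sum_Icc_succ_top (by omega), Finset.sum_Icc_succ_top (by omega), ih,
      ← add_assoc, ← add_assoc, ← add_assoc, lucasCobalancing_add_one, lucasCobalancing_add_one]
    have h : balancing (n + 2 * j + 1 + 1) =
      6 * balancing (n + 2 * j + 1) - balancing (n + 2 * j) := rfl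
    have hadd := balancing_add_add_one j (n + j)
    rw [show j + (n + j) + 1 = n + 2 * j + 1 by ring] at hadd
    linear_combination h + 8 * hadd

theorem sum_lucasCobalancing_two_mul_add_one (n j : ℕ) :
    ∑ i ∈ Finset.Icc 1 (2 * j + 1), lucasCobalancing (n + i) =
      assocPell (2 * j + 1) * lucasCobalancing (n + (j + 1)) := by
  have h := balancing_add j (n + j)
  have h₁ := balancing_add_add_one j (n + j)
  rw [show j + (n + j) = n + 2 * j by ring] at h h₁
  rw [Finset.sum_Icc_succ_top (by omega), sum_lucasCobalancing_two_mul, pell_two_mul,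
    assocPell_two_mul_add_one, ← add_assoc, ← add_assoc, lucasCobalancing_add_one,
    lucasCobalancing_add_one, lucasCobalancing_add_one]
  linear_combination h + h₁

/-- A shift of a sequence with `xₙ₊₂ = 6xₙ₊₁ − xₙ` and `x₁ = 1`, scaled by `d`, has gcd `d`. -/
theorem IsSetGCD.of_eq_mul_shift {S x : ℕ → ℤ} {d : ℤ} (j : ℕ)
    (hx : ∀ n, x (n + 2) = 6 * x (n + 1) - x n) (hx₁ : x 1 = 1) (hd : 1 ≤ d)
    (hS : ∀ n, S n = d * x (n + j)) : IsSetGCD S d := by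
  refine ⟨hd, fun n => ⟨_, hS n⟩, fun e he => ?_⟩
  have hshift : ∀ n, e ∣ d * x (n + j) := fun n => hS n ▸ he n
  clear hS he
  induction j with
  | zero => simpa [hx₁] using hshift 1
  | succ j ih =>
    refine ih fun n => ?_
    have h : d * x (n + j) = 6 * (d * x (n + (j + 1))) - d * x (n + 1 + (j + 1)) := by
      rw [show n + 1 + (j + 1) = n + j + 2 by ring, hx, ← add_assoc]
      ring
    exact h ▸ ((hshift n).mul_left 6).sub (hshift (n + 1))

theorem gcd_sums_lucasCobalancing (k : ℕ) (hk : 1 ≤ k) :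
    (Even k →
      IsSetGCD (fun n => ∑ i ∈ Finset.Icc 1 k, lucasCobalancing (n + i)) (4 * pell k)) ∧
    (Odd k →
      IsSetGCD (fun n => ∑ i ∈ Finset.Icc 1 k, lucasCobalancing (n + i)) (assocPell k)) := by
  constructor
  · intro h
    obtain ⟨j, rfl⟩ := h.two_dvd
    exact .of_eq_mul_shift (x := balancing) j (fun _ => rfl) rfl (by linarith [pell_pos hk])
      fun n => sum_lucasCobalancing_two_mul n j
  · rintro ⟨j, rfl⟩
    exact .of_eq_mul_shift (x := lucasCobalancing) (j + 1) (fun _ => rfl) rfl (assocPell_pos _)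
      fun n => sum_lucasCobalancing_two_mul_add_one n j
end
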